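/- Assume the ideal J is prime and the image of X₁ − X₂ in A = ℂ[X₁,Y₁,X₂,Y₂]/J is nonzero. Let ψ₁ : ℂ[t₂,t₄,t₅,t₇] → Frac(A) be the ℂ-algebra homomorphism from the polynomial ring in four variables to the fraction field of A sending t₂ ↦ ū₂, t₄ ↦ ū₄, t₅ ↦ ū₅, t₇ ↦ ū₇. Then the kernel of ψ₁ equals the ideal T of ℂ[t₂,t₄,t₅,t₇] generated by the two polynomials H₁₂ = 2t₅t₇ − 7t₂⁶ − 35t₂⁴t₄ − 21t₂²t₄² − t₄³ − y₄(5t₂⁴ + 10t₂²t₄ + t₄²) + 4y₆(t₂³ + t₂t₄) − y₈(3t₂² + t₄) + 2y₁₀t₂ − y₁₂ and H₁₄ = −t₇² − t₄t₅² + 2t₂t₅t₇ − 6t₂⁷ − 14t₂⁵t₄ + 14t₂³t₄² + 6t₂t₄³ − 4y₄(t₂⁵ − t₂t₄²) + y₆(3t₂⁴ − 2t₂²t₄ − t₄²) − 2y₈(t₂³ − t₂t₄) + y₁₀(t₂² − t₄) − y₁₄. -/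

import Mathlib

/- Context: Q(X) = X⁷ + y₄X⁵ − y₆X⁴ + y₈X³ − y₁₀X² + y₁₂X − y₁₄; J is the ideal of
ℂ[X₁,Y₁,X₂,Y₂] (variables 0 ↦ X₁, 1 ↦ Y₁, 2 ↦ X₂, 3 ↦ Y₂) generated by Y₁² − Q(X₁)
and Y₂² − Q(X₂); A = ℂ[X₁,Y₁,X₂,Y₂]/J.  In the polynomial ring ℂ[t₂,t₄,t₅,t₇] the
variables are indexed 0 ↦ t₂, 1 ↦ t₄, 2 ↦ t₅, 3 ↦ t₇. -/

open MvPolynomial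

set_option synthInstance.maxHeartbeats 1000000
set_option maxHeartbeats 1000000

noncomputable section

/-- `Q(Xᵢ)` as a polynomial in `ℂ[X₁,Y₁,X₂,Y₂]`. -/
def Qp (y4 y6 y8 y10 y12 y14 : ℂ) (i : Fin 4) : MvPolynomial (Fin 4) ℂ :=
  X i ^ 7 + C y4 * X i ^ 5 - C y6 * X i ^ 4 + C y8 * X i ^ 3
    - C y10 * X i ^ 2 + C y12 * X i - C y14

/-- The ideal `J = (Y₁² − Q(X₁), Y₂² − Q(X₂))`. -/
def Jideal (y4 y6 y8 y10 y12 y14 : ℂ) : Ideal (MvPolynomial (Fin 4) ℂ) :=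
  Ideal.span {X 1 ^ 2 - Qp y4 y6 y8 y10 y12 y14 0, X 3 ^ 2 - Qp y4 y6 y8 y10 y12 y14 2}

/-- The polynomial `H₁₂ ∈ ℂ[t₂,t₄,t₅,t₇]`. -/
def H12 (y4 y6 y8 y10 y12 : ℂ) : MvPolynomial (Fin 4) ℂ :=
  2 * X 2 * X 3 - 7 * X 0 ^ 6 - 35 * X 0 ^ 4 * X 1 - 21 * X 0 ^ 2 * X 1 ^ 2 - X 1 ^ 3
    - C y4 * (5 * X 0 ^ 4 + 10 * X 0 ^ 2 * X 1 + X 1 ^ 2)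
    + 4 * C y6 * (X 0 ^ 3 + X 0 * X 1) - C y8 * (3 * X 0 ^ 2 + X 1)
    + 2 * C y10 * X 0 - C y12

/-- The polynomial `H₁₄ ∈ ℂ[t₂,t₄,t₅,t₇]`. -/
def H14 (y4 y6 y8 y10 y14 : ℂ) : MvPolynomial (Fin 4) ℂ :=
  - X 3 ^ 2 - X 1 * X 2 ^ 2 + 2 * X 0 * X 2 * X 3 - 6 * X 0 ^ 7 - 14 * X 0 ^ 5 * X 1
    + 14 * X 0 ^ 3 * X 1 ^ 2 + 6 * X 0 * X 1 ^ 3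
    - 4 * C y4 * (X 0 ^ 5 - X 0 * X 1 ^ 2)
    + C y6 * (3 * X 0 ^ 4 - 2 * X 0 ^ 2 * X 1 - X 1 ^ 2)
    - 2 * C y8 * (X 0 ^ 3 - X 0 * X 1) + C y10 * (X 0 ^ 2 - X 1) - C y14

/-- The restriction of `H₁₂` to `t₄ = 0`. -/
def H12bar (y4 y6 y8 y10 y12 : ℂ) : MvPolynomial (Fin 4) ℂ :=
  2 * X 2 * X 3 - (7 * X 0 ^ 6 + 5 * C y4 * X 0 ^ 4 - 4 * C y6 * X 0 ^ 3 + 3 * C y8 * X 0 ^ 2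
    - 2 * C y10 * X 0 + C y12)

/-- The substitution `t₄ ↦ 0` changes a polynomial by a multiple of `t₄`. -/
lemma X_one_dvd_sub_aeval_zero (p : MvPolynomial (Fin 4) ℂ) :
    X 1 ∣ p - aeval (R := ℂ) ![X 0, 0, X 2, X 3] p := by
  induction p using MvPolynomial.induction_on with
  | C a => simp [algebraMap_eq]
  | add p q hp hq =>
    rw [map_add, add_sub_add_comm]
    exact dvd_add hp hq
  | mul_X p i hp =>
    have hX : (X 1 : MvPolynomial (Fin 4) ℂ) ∣ X i - aeval (R := ℂ) ![X 0, 0, X 2, X 3] (X i) := by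
      fin_cases i <;> simp
    rw [map_mul]
    exact dvd_mul_sub_mul hp hX

lemma Qp_zero_not_dvd (y4 y6 y8 y10 y12 y14 : ℂ) :
    ¬ X 3 ∣ Qp y4 y6 y8 y10 y12 y14 0 := by
  rintro ⟨g, hg⟩
  have h := congrArg (aeval ![(Polynomial.X : Polynomial ℂ), 0, 0, 0]) hg
  have h7 := congrArg (fun p : Polynomial ℂ => p.coeff 7) h
  simp [Qp] at h7

lemma isRelPrime_sq_sub_Qp_H12bar (y4 y6 y8 y10 y12 y14 : ℂ) :
    IsRelPrime (X 3 ^ 2 - Qp y4 y6 y8 y10 y12 y14 0) (H12bar y4 y6 y8 y10 y12) := by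
  intro d hdc hdh
  have hQ := Qp_zero_not_dvd y4 y6 y8 y10 y12 y14
  set c := X 3 ^ 2 - Qp y4 y6 y8 y10 y12 y14 0 with hc
  have hc0 : c ≠ 0 := fun h => hQ ⟨X 3, by rw [← sq]; exact (sub_eq_zero.mp h).symm⟩
  have hcdeg : c.degreeOf 2 = 0 := by
    have hmem : c ∈ supported ℂ ({0, 3} : Set (Fin 4)) := by
      have h0 : (X 0 : MvPolynomial (Fin 4) ℂ) ∈ supported ℂ ({0, 3} : Set (Fin 4)) :=
        X_mem_supported.mpr (by simp)
      have h3 : (X 3 : MvPolynomial (Fin 4) ℂ) ∈ supported ℂ ({0, 3} : Set (Fin 4)) :=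
        X_mem_supported.mpr (by simp)
      have hC (a : ℂ) : (C a : MvPolynomial (Fin 4) ℂ) ∈ supported ℂ ({0, 3} : Set (Fin 4)) :=
        Subalgebra.algebraMap_mem _ a
      rw [hc, Qp]
      exact sub_mem (pow_mem h3 2) (sub_mem (add_mem (sub_mem (add_mem (sub_mem (add_mem
        (pow_mem h0 7) (mul_mem (hC _) (pow_mem h0 5))) (mul_mem (hC _) (pow_mem h0 4)))
        (mul_mem (hC _) (pow_mem h0 3))) (mul_mem (hC _) (pow_mem h0 2))) (mul_mem (hC _) h0)) (hC _))
    by_contra hne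
    have := mem_supported.mp hmem (mem_vars_iff_degreeOf_ne_zero.mpr hne)
    simp at this
  obtain ⟨e, he⟩ := hdc
  have hd0 : d ≠ 0 := by rintro rfl; simp [he] at hc0
  have he0 : e ≠ 0 := by rintro rfl; simp [he] at hc0
  have hddeg : d.degreeOf 2 = 0 := by
    have := degreeOf_mul_eq (n := 2) hd0 he0
    rw [← he, hcdeg] at this
    omega
  have hfix (a : ℂ) : aeval ![X 0, X 1, C a, X 3] d = d := by
    conv_rhs => rw [← aeval_X_left_apply d]
    refine eval₂Hom_congr' rfl (fun i hi _ => ?_) rfl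
    have hi2 : i ≠ 2 := by rintro rfl; exact mem_vars_iff_degreeOf_ne_zero.mp hi hddeg
    fin_cases i <;> simp at hi2 ⊢
  have hdvd (a : ℂ) : d ∣ aeval ![X 0, X 1, C a, X 3] (H12bar y4 y6 y8 y10 y12) := by
    conv_lhs => rw [← hfix a]
    exact map_dvd _ hdh
  have hd3 : d ∣ X 3 := by
    have h := (dvd_sub (hdvd 1) (hdvd 0)).mul_left (C (1 / 2))
    convert h using 1
    have h2 : (C (1 / 2) * 2 : MvPolynomial (Fin 4) ℂ) = 1 := by
      rw [← map_ofNat C 2, ← C_mul]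
      norm_num
    simp only [H12bar, map_sub, map_add, map_mul, map_pow, map_ofNat, aeval_X, algHom_C,
      algebraMap_eq, Matrix.cons_val, C_0, C_1]
    linear_combination -X 3 * h2
  by_contra hu
  have hassoc : X 3 ∣ d := by
    obtain ⟨k, hk⟩ := hd3
    have hirr : Irreducible (X 3 : MvPolynomial (Fin 4) ℂ) := (X_prime).irreducible
    have hku := (hirr.isUnit_or_isUnit hk).resolve_left hu
    rw [hk]
    exact hku.mul_right_dvd.mpr dvd_rfl
  apply hQ
  have h : X 3 ∣ c := hassoc.trans ⟨e, he⟩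
  rw [hc] at h
  exact (dvd_sub_right (dvd_pow_self _ two_ne_zero)).mp h

/-- `t₄` is a nonzerodivisor modulo `(H₁₂, H₁₄)`. -/
lemma mem_span_of_X_one_mul_mem (y4 y6 y8 y10 y12 y14 : ℂ) {f : MvPolynomial (Fin 4) ℂ}
    (hf : X 1 * f ∈ Ideal.span {H12 y4 y6 y8 y10 y12, H14 y4 y6 y8 y10 y14}) :
    f ∈ Ideal.span {H12 y4 y6 y8 y10 y12, H14 y4 y6 y8 y10 y14} := by
  obtain ⟨p, q, hpq⟩ := Ideal.mem_span_pair.mp hf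
  set π : MvPolynomial (Fin 4) ℂ →ₐ[ℂ] MvPolynomial (Fin 4) ℂ := aeval ![X 0, 0, X 2, X 3]
    with hπ
  have hπ12 : π (H12 y4 y6 y8 y10 y12) = H12bar y4 y6 y8 y10 y12 := by
    simp only [hπ, H12, H12bar, map_sub, map_add, map_mul, map_pow, map_ofNat, aeval_X,
      algHom_C, algebraMap_eq, Matrix.cons_val]
    ring
  have hπ14 : π (H14 y4 y6 y8 y10 y14) = X 0 * H12bar y4 y6 y8 y10 y12
      - (X 3 ^ 2 - Qp y4 y6 y8 y10 y12 y14 0) := by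
    simp only [hπ, H14, H12bar, Qp, map_sub, map_add, map_neg, map_mul, map_pow, map_ofNat, aeval_X,
      algHom_C, algebraMap_eq, Matrix.cons_val]
    ring
  have h0 : π p * π (H12 y4 y6 y8 y10 y12) + π q * π (H14 y4 y6 y8 y10 y14) = 0 := by
    rw [← map_mul, ← map_mul, ← map_add, hpq]
    simp [hπ]
  have hdvd (p) : X 1 ∣ p - π p := X_one_dvd_sub_aeval_zero p
  have hrel := isRelPrime_sq_sub_Qp_H12bar y4 y6 y8 y10 y12 y14
  have hc0 : X 3 ^ 2 - Qp y4 y6 y8 y10 y12 y14 0 ≠ 0 := fun h =>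
    Qp_zero_not_dvd y4 y6 y8 y10 y12 y14 ⟨X 3, by rw [← sq]; exact (sub_eq_zero.mp h).symm⟩
  rw [hπ12, hπ14] at h0
  obtain ⟨r, hr⟩ : X 3 ^ 2 - Qp y4 y6 y8 y10 y12 y14 0 ∣ π p + X 0 * π q :=
    hrel.dvd_of_dvd_mul_right ⟨π q, by linear_combination h0⟩
  have hq : π q = r * H12bar y4 y6 y8 y10 y12 := by
    apply mul_left_cancel₀ hc0
    linear_combination H12bar y4 y6 y8 y10 y12 * hr - h0
  have hp : π p = - r * π (H14 y4 y6 y8 y10 y14) := by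
    rw [hπ14]
    linear_combination hr - X 0 * hq
  rw [← hπ12] at hq
  obtain ⟨a, ha⟩ := hdvd p
  obtain ⟨b, hb⟩ := hdvd q
  obtain ⟨s, hs⟩ := hdvd (H12 y4 y6 y8 y10 y12)
  obtain ⟨t, ht⟩ := hdvd (H14 y4 y6 y8 y10 y14)
  refine Ideal.mem_span_pair.mpr ⟨a + r * t, b - r * s, ?_⟩
  apply mul_left_cancel₀ (X_ne_zero (R := ℂ) (1 : Fin 4))
  rw [← hpq]
  linear_combination (-H12 y4 y6 y8 y10 y12) * (ha + r * ht + hp)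
    - H14 y4 y6 y8 y10 y14 * (hb - r * hs + hq)

/-- Over a ring containing a square root `b` of `t₄`, the points of the two affine varieties are
related by `x₁, x₂ = t₂ ± b` and `y₁, y₂ = t₇ ± b t₅`; this gives the defining equations of the
first in terms of those of the second. -/
lemma aeval_gens_eq {B : Type*} [CommRing B] [Algebra ℂ B] (y4 y6 y8 y10 y12 y14 : ℂ)
    (a b c d : B) :
    aeval ![a + b, d + b * c, a - b, d - b * c] (X 1 ^ 2 - Qp y4 y6 y8 y10 y12 y14 0)
      = (a + b) * aeval ![a, b ^ 2, c, d] (H12 y4 y6 y8 y10 y12)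
        - aeval ![a, b ^ 2, c, d] (H14 y4 y6 y8 y10 y14) ∧
    aeval ![a + b, d + b * c, a - b, d - b * c] (X 3 ^ 2 - Qp y4 y6 y8 y10 y12 y14 2)
      = (a - b) * aeval ![a, b ^ 2, c, d] (H12 y4 y6 y8 y10 y12)
        - aeval ![a, b ^ 2, c, d] (H14 y4 y6 y8 y10 y14) := by
  simp only [H12, H14, Qp, map_sub, map_add, map_neg, map_mul, map_pow, map_ofNat, aeval_X,
    algHom_C, Matrix.cons_val]
  constructor <;> ring

/-- Multiplying by a power of `b = (x₁ - x₂) / 2` turns a polynomial in `t₂, t₄, t₅, t₇` into a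
polynomial in `x₁, y₁, x₂, y₂`. -/
lemma exists_aeval_eq_pow_mul_aeval (f : MvPolynomial (Fin 4) ℂ) :
    ∃ (N : ℕ) (g : MvPolynomial (Fin 4) ℂ), ∀ (B : Type) [CommRing B] [Algebra ℂ B]
      (a b c d : B), aeval ![a + b, d + b * c, a - b, d - b * c] g
        = b ^ N * aeval ![a, b ^ 2, c, d] f := by
  have half (B : Type) [CommRing B] [Algebra ℂ B] : algebraMap ℂ B (1 / 2) * 2 = 1 := by
    rw [← map_ofNat (algebraMap ℂ B) 2, ← map_mul]
    norm_num
  induction f using MvPolynomial.induction_on with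
  | C r => exact ⟨0, C r, fun B _ _ a b c d => by simp⟩
  | add p q hp hq =>
    obtain ⟨M, g, hg⟩ := hp
    obtain ⟨N, h, hh⟩ := hq
    refine ⟨M + N, (C (1 / 2) * (X 0 - X 2)) ^ N * g + (C (1 / 2) * (X 0 - X 2)) ^ M * h,
      fun B _ _ a b c d => ?_⟩
    have hb : algebraMap ℂ B (1 / 2) * (a + b - (a - b)) = b := by
      linear_combination b * half B
    simp only [map_add, map_mul, map_pow, map_sub, hg, hh, aeval_X, algHom_C, Matrix.cons_val, hb]
    ring
  | mul_X p i hp =>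
    obtain ⟨M, g, hg⟩ := hp
    suffices h : ∃ (N : ℕ) (h : MvPolynomial (Fin 4) ℂ), ∀ (B : Type) [CommRing B] [Algebra ℂ B]
        (a b c d : B), aeval ![a + b, d + b * c, a - b, d - b * c] h
          = b ^ N * ![a, b ^ 2, c, d] i by
      obtain ⟨N, h, hh⟩ := h
      refine ⟨M + N, g * h, fun B _ _ a b c d => ?_⟩
      rw [map_mul, map_mul, hg, hh, aeval_X]
      ring
    fin_cases i
    · refine ⟨0, C (1 / 2) * (X 0 + X 2), fun B _ _ a b c d => ?_⟩
      simp only [map_add, map_mul, aeval_X, algHom_C, Matrix.cons_val, Fin.zero_eta]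
      linear_combination a * half B
    · refine ⟨0, (C (1 / 2) * (X 0 - X 2)) ^ 2, fun B _ _ a b c d => ?_⟩
      simp only [map_sub, map_mul, map_pow, aeval_X, algHom_C, Matrix.cons_val, Fin.mk_one]
      linear_combination (b ^ 2 * (algebraMap ℂ B (1 / 2) * 2 + 1)) * half B
    · refine ⟨1, C (1 / 2) * (X 1 - X 3), fun B _ _ a b c d => ?_⟩
      simp only [map_sub, map_mul, aeval_X, algHom_C, Matrix.cons_val, Fin.reduceFinMk]
      linear_combination b * c * half B
    · refine ⟨0, C (1 / 2) * (X 1 + X 3), fun B _ _ a b c d => ?_⟩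
      simp only [map_add, map_mul, aeval_X, algHom_C, Matrix.cons_val, Fin.reduceFinMk]
      linear_combination d * half B

lemma mem_span_of_X_one_pow_mul_mem (y4 y6 y8 y10 y12 y14 : ℂ) {f : MvPolynomial (Fin 4) ℂ}
    (n : ℕ) (hf : X 1 ^ n * f ∈ Ideal.span {H12 y4 y6 y8 y10 y12, H14 y4 y6 y8 y10 y14}) :
    f ∈ Ideal.span {H12 y4 y6 y8 y10 y12, H14 y4 y6 y8 y10 y14} := by
  induction n with
  | zero => simpa using hf
  | succ n ih =>
    rw [pow_succ', mul_assoc] at hf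
    exact ih (mem_span_of_X_one_mul_mem y4 y6 y8 y10 y12 y14 hf)

/-- The kernel of `ψ₁`, for an arbitrary field point of the parameter space whose kernel on
`ℂ[X₁,Y₁,X₂,Y₂]` is `J`. -/
lemma ker_aeval_eq_span {K : Type} [Field K] [Algebra ℂ K] (y4 y6 y8 y10 y12 y14 : ℂ)
    {a b c d : K} (hb : b ≠ 0)
    (hker : RingHom.ker (aeval (R := ℂ) ![a + b, d + b * c, a - b, d - b * c])
      = Jideal y4 y6 y8 y10 y12 y14) :
    RingHom.ker (aeval (R := ℂ) ![a, b ^ 2, c, d])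
      = Ideal.span {H12 y4 y6 y8 y10 y12, H14 y4 y6 y8 y10 y14} := by
  apply le_antisymm
  · intro f hf
    obtain ⟨N, g, hg⟩ := exists_aeval_eq_pow_mul_aeval f
    have hgJ : g ∈ Jideal y4 y6 y8 y10 y12 y14 := by
      rw [← hker, RingHom.mem_ker, hg, RingHom.mem_ker.mp hf, mul_zero]
    let S := QuadraticAlgebra (MvPolynomial (Fin 4) ℂ) (X 1) 0
    let σ := algebraMap (MvPolynomial (Fin 4) ℂ) S
    let ω : S := QuadraticAlgebra.omega
    have hω : ω ^ 2 = σ (X 1) := by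
      rw [sq]
      exact QuadraticAlgebra.omega_mul_omega_eq_mk
    have hσ (p : MvPolynomial (Fin 4) ℂ) :
        aeval ![σ (X 0), ω ^ 2, σ (X 2), σ (X 3)] p = σ p := by
      have : aeval ![σ (X 0), ω ^ 2, σ (X 2), σ (X 3)]
          = IsScalarTower.toAlgHom ℂ (MvPolynomial (Fin 4) ℂ) S := by
        apply MvPolynomial.algHom_ext
        intro i
        fin_cases i <;> simp [σ, hω]
      rw [this]
      rfl
    set T := Ideal.span {H12 y4 y6 y8 y10 y12, H14 y4 y6 y8 y10 y14} with hT
    have h12 : σ (H12 y4 y6 y8 y10 y12) ∈ T.map σ :=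
      Ideal.mem_map_of_mem σ (Ideal.subset_span (by simp))
    have h14 : σ (H14 y4 y6 y8 y10 y14) ∈ T.map σ :=
      Ideal.mem_map_of_mem σ (Ideal.subset_span (by simp))
    have hle : Jideal y4 y6 y8 y10 y12 y14 ≤ (T.map σ).comap (aeval (R := ℂ)
        ![σ (X 0) + ω, σ (X 3) + ω * σ (X 2), σ (X 0) - ω, σ (X 3) - ω * σ (X 2)]) := by
      have hgens := aeval_gens_eq y4 y6 y8 y10 y12 y14 (σ (X 0)) ω (σ (X 2)) (σ (X 3))
      rw [hσ, hσ] at hgens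
      rw [Jideal, Ideal.span_le]
      rintro p (rfl | rfl)
      · rw [SetLike.mem_coe, Ideal.mem_comap, hgens.1]
        exact sub_mem (Ideal.mul_mem_left _ _ h12) h14
      · rw [SetLike.mem_coe, Ideal.mem_comap, hgens.2]
        exact sub_mem (Ideal.mul_mem_left _ _ h12) h14
    have hmem := Ideal.mul_mem_left _ (ω ^ N) (Ideal.mem_comap.mp (hle hgJ))
    rw [hg, hσ, ← mul_assoc, ← mul_pow, ← sq, hω, ← map_pow, ← map_mul, ← Ideal.mem_comap,
      Ideal.comap_map_eq_self_of_faithfullyFlat] at hmem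
    exact mem_span_of_X_one_pow_mul_mem y4 y6 y8 y10 y12 y14 N hmem
  · have hgens := aeval_gens_eq y4 y6 y8 y10 y12 y14 a b c d
    have h1 : X 1 ^ 2 - Qp y4 y6 y8 y10 y12 y14 0 ∈ Jideal y4 y6 y8 y10 y12 y14 :=
      Ideal.subset_span (by simp)
    have h2 : X 3 ^ 2 - Qp y4 y6 y8 y10 y12 y14 2 ∈ Jideal y4 y6 y8 y10 y12 y14 :=
      Ideal.subset_span (by simp)
    rw [← hker, RingHom.mem_ker] at h1 h2
    rw [h1, h2] at hgens
    have : CharZero K := charZero_of_injective_algebraMap (algebraMap ℂ K).injective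
    have h12 : aeval ![a, b ^ 2, c, d] (H12 y4 y6 y8 y10 y12) = 0 := by
      apply mul_left_cancel₀ (mul_ne_zero two_ne_zero hb)
      linear_combination hgens.2 - hgens.1
    rw [Ideal.span_le]
    rintro p (rfl | rfl)
    · exact h12
    · rw [SetLike.mem_coe, RingHom.mem_ker]
      linear_combination hgens.1 + (a + b) * h12

/-- If `J` is prime and `x₁ − x₂ ≠ 0` in `A = ℂ[X₁,Y₁,X₂,Y₂]/J`, then the kernel of
the ℂ-algebra map `ψ₁ : ℂ[t₂,t₄,t₅,t₇] → Frac(A)`, sending `t₂ ↦ ū₂`, `t₄ ↦ ū₄`,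
`t₅ ↦ ū₅`, `t₇ ↦ ū₇`, is the ideal `T = (H₁₂, H₁₄)`. -/
theorem statement5 (y4 y6 y8 y10 y12 y14 : ℂ)
    (hJ : (Jideal y4 y6 y8 y10 y12 y14).IsPrime)
    (hx : Ideal.Quotient.mk (Jideal y4 y6 y8 y10 y12 y14) (X 0 - X 2) ≠ 0) :
    haveI := hJ
    let ι : MvPolynomial (Fin 4) ℂ →
        FractionRing (MvPolynomial (Fin 4) ℂ ⧸ Jideal y4 y6 y8 y10 y12 y14) :=
      fun f => algebraMap (MvPolynomial (Fin 4) ℂ ⧸ Jideal y4 y6 y8 y10 y12 y14) (FractionRing (MvPolynomial (Fin 4) ℂ ⧸ Jideal y4 y6 y8 y10 y12 y14)) (Ideal.Quotient.mk (Jideal y4 y6 y8 y10 y12 y14) f)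
    let u2 := (ι (X 0) + ι (X 2)) / 2
    let u4 := (ι (X 0) - ι (X 2)) ^ 2 / 4
    let u5 := (ι (X 1) - ι (X 3)) / (ι (X 0) - ι (X 2))
    let u7 := (ι (X 1) + ι (X 3)) / 2
    RingHom.ker (aeval ![u2, u4, u5, u7] :
        MvPolynomial (Fin 4) ℂ →ₐ[ℂ] _) =
      Ideal.span {H12 y4 y6 y8 y10 y12, H14 y4 y6 y8 y10 y14} := by
  intro ι u2 u4 u5 u7
  let A := MvPolynomial (Fin 4) ℂ ⧸ Jideal y4 y6 y8 y10 y12 y14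
  let φ : MvPolynomial (Fin 4) ℂ →ₐ[ℂ] FractionRing A :=
    (IsScalarTower.toAlgHom ℂ A (FractionRing A)).comp (Ideal.Quotient.mkₐ ℂ _)
  have hinj : Function.Injective (algebraMap A (FractionRing A)) := IsFractionRing.injective _ _
  have hφker : RingHom.ker φ = Jideal y4 y6 y8 y10 y12 y14 := by
    ext p
    rw [RingHom.mem_ker, ← Ideal.Quotient.eq_zero_iff_mem]
    exact map_eq_zero_iff _ hinj
  have hsub : ι (X 0) - ι (X 2) ≠ 0 := by
    have h : φ (X 0 - X 2) ≠ 0 := (map_ne_zero_iff _ hinj).mpr hx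
    rwa [map_sub] at h
  have : CharZero (FractionRing A) := charZero_of_injective_algebraMap (algebraMap ℂ _).injective
  let b := (ι (X 0) - ι (X 2)) / 2
  have hb : b ≠ 0 := div_ne_zero hsub two_ne_zero
  have hu4 : u4 = b ^ 2 := by
    simp only [u4, b]
    ring
  have hbu5 : b * u5 = (ι (X 1) - ι (X 3)) / 2 := by
    simp only [b, u5]
    field_simp
  have hφ : aeval ![u2 + b, u7 + b * u5, u2 - b, u7 - b * u5] = φ := by
    apply MvPolynomial.algHom_ext
    intro i
    rw [hbu5, aeval_X]
    change _ = ι (X i)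
    fin_cases i <;> simp [u2, u7, b] <;> ring
  rw [hu4]
  exact ker_aeval_eq_span y4 y6 y8 y10 y12 y14 hb (hφ ▸ hφker)

end
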